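/- arXiv:1804.06831 — 9 statements merged into one kernel-verified Lean document; each statement's English description precedes it below -/
import Mathlib

section
/- Let α, β ∈ [0,1] and let W_m > L_m and W_{1−m} > L_{1−m} be real numbers. Suppose both sender types pool on message m, the receiver plays a = m when e = 0 and a = 1−m when e = 1 on the equilibrium path, and would respond to the off-path message 1−m with a = 1−m when e = 0 and a = m when e = 1. Then: the type-m sender's on-path expected payoff is L_m(1−α) + W_m α and her deviation payoff is L_m β + W_m(1−β), and she strictly gains by deviating if and only if β < 1−α; the type-(1−m) sender's on-path expected payoff is L_{1−m}β + W_{1−m}(1−β) and her deviation payoff is L_{1−m}(1−α) + W_{1−m}α, and she strictly gains by deviating if and only if β > 1−α. Hence if β ≠ 1−α, exactly one sender type strictly prefers to deviate. -/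
/-- Alarm probability: `α` if the message is truthful (`m' = θ`), `β` if deceptive. -/
noncomputable def alarmProb (α β : ℝ) (θ m' : Bool) : ℝ := if m' = θ then α else β

/-- Message-independent sender utility: `L θ` if the receiver plays `a = θ`,
`W θ` if `a ≠ θ` (successful deception). -/
noncomputable def senderU (L W : Bool → ℝ) (θ a : Bool) : ℝ := if a = θ then L θ else W θ

/-- Expected payoff of a type-`θ` sender sending message `m'` against the
response rule `resp : evidence → action`. -/
noncomputable def payoff (α β : ℝ) (L W : Bool → ℝ) (θ m' : Bool) (resp : Bool → Bool) : ℝ :=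
  (1 - alarmProb α β θ m') * senderU L W θ (resp false)
    + alarmProb α β θ m' * senderU L W θ (resp true)

theorem lt_mix_iff {l w a b : ℝ} (h : l < w) :
    l * (1 - a) + w * a < l * (1 - b) + w * b ↔ a < b := by
  have key : l * (1 - b) + w * b - (l * (1 - a) + w * a) = (w - l) * (b - a) := by ring
  rw [← sub_pos, key, mul_pos_iff_of_pos_left (sub_pos.2 h), sub_pos]

/-- **Deviation incentives in the Middle-regime pooling candidate.** Both sender types
pool on `m`; on the equilibrium path the receiver plays `a = m` when `e = 0` and
`a = 1−m` when `e = 1`, and off the path (message `1−m`) he plays `a = 1−m` when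
`e = 0` and `a = m` when `e = 1`. Then the type-`m` sender's on-path payoff is
`L_m(1−α)+W_m α`, her deviation payoff is `L_m β + W_m(1−β)`, and she strictly gains by
deviating iff `β < 1−α`; the type-`(1−m)` sender's on-path payoff is
`L_{1−m}β + W_{1−m}(1−β)`, her deviation payoff is `L_{1−m}(1−α)+W_{1−m}α`, and she
strictly gains by deviating iff `β > 1−α`. Hence if `β ≠ 1−α`, exactly one type
strictly prefers to deviate. -/
theorem pooling_deviation_incentives
    (α β : ℝ) (L W : Bool → ℝ) (m : Bool)
    (hα0 : 0 ≤ α) (hα1 : α ≤ 1) (hβ0 : 0 ≤ β) (hβ1 : β ≤ 1)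
    (hm : L m < W m) (hn : L (!m) < W (!m)) :
    payoff α β L W m m (fun e => if e then !m else m) = L m * (1 - α) + W m * α ∧
    payoff α β L W m (!m) (fun e => if e then m else !m) = L m * β + W m * (1 - β) ∧
    (payoff α β L W m (!m) (fun e => if e then m else !m) >
        payoff α β L W m m (fun e => if e then !m else m) ↔ β < 1 - α) ∧
    payoff α β L W (!m) m (fun e => if e then !m else m)
      = L (!m) * β + W (!m) * (1 - β) ∧
    payoff α β L W (!m) (!m) (fun e => if e then m else !m)
      = L (!m) * (1 - α) + W (!m) * α ∧
    (payoff α β L W (!m) (!m) (fun e => if e then m else !m) >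
        payoff α β L W (!m) m (fun e => if e then !m else m) ↔ β > 1 - α) ∧
    (β ≠ 1 - α →
      Xor' (payoff α β L W m (!m) (fun e => if e then m else !m) >
              payoff α β L W m m (fun e => if e then !m else m))
           (payoff α β L W (!m) (!m) (fun e => if e then m else !m) >
              payoff α β L W (!m) m (fun e => if e then !m else m))) := by
  have onPath : payoff α β L W m m (fun e => if e then !m else m)
      = L m * (1 - α) + W m * α := by
    simp [payoff, alarmProb, senderU]; ring
  have offPath : payoff α β L W m (!m) (fun e => if e then m else !m)
      = L m * β + W m * (1 - β) := by
    simp [payoff, alarmProb, senderU]; ring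
  have onPath' : payoff α β L W (!m) m (fun e => if e then !m else m)
      = L (!m) * β + W (!m) * (1 - β) := by
    simp [payoff, alarmProb, senderU]; ring
  have offPath' : payoff α β L W (!m) (!m) (fun e => if e then m else !m)
      = L (!m) * (1 - α) + W (!m) * α := by
    simp [payoff, alarmProb, senderU]; ring
  have gain : payoff α β L W m (!m) (fun e => if e then m else !m) >
      payoff α β L W m m (fun e => if e then !m else m) ↔ β < 1 - α := by
    have h := lt_mix_iff (a := α) (b := 1 - β) hm
    rw [sub_sub_cancel] at h
    rw [onPath, offPath, gt_iff_lt, h, lt_sub_comm]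
  have gain' : payoff α β L W (!m) (!m) (fun e => if e then m else !m) >
      payoff α β L W (!m) m (fun e => if e then !m else m) ↔ β > 1 - α := by
    have h := lt_mix_iff (a := 1 - β) (b := α) hn
    rw [sub_sub_cancel] at h
    rw [onPath', offPath', gt_iff_lt, h, gt_iff_lt, sub_lt_comm]
  refine ⟨onPath, offPath, gain, onPath', offPath', gain', fun hne => ?_⟩
  rw [gain, gain']
  exact hne.lt_or_gt.imp (fun h => ⟨h, h.not_gt⟩) (fun h => ⟨h, h.not_gt⟩)
end

section
/- Let α, β ∈ [0,1] with α < 1 and β > 0, and let W_m > L_m and W_{1−m} > L_{1−m} be real numbers. Suppose both sender types pool on message m, the receiver plays a = m when e = 0 and a = 1−m when e = 1 on the equilibrium path, and would respond to the off-path message 1−m with the same fixed action a° ∈ {0,1} for both values of e. Then the sender of type 1−a° strictly gains by deviating to message 1−m: her deviation payoff is W_{1−a°} with certainty, while her on-path payoff is a mixture that puts positive weight on L_{1−a°} (weight 1−α if 1−a° = m, weight β if 1−a° = 1−m), hence is strictly smaller than W_{1−a°}. -/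
/-- **A constant off-path response cannot deter deviation.** Let `α, β ∈ [0,1]` with
`α < 1` and `β > 0`. Both sender types pool on `m`; on the path the receiver plays
`a = m` when `e = 0` and `a = 1−m` when `e = 1`; off the path (message `1−m`) he plays
the same fixed action `a° ∈ {0,1}` for both values of `e`. Then the sender of type
`1−a°` strictly gains by deviating to `1−m`: her deviation payoff is `W_{1−a°}` with
certainty, which strictly exceeds her on-path payoff. -/
theorem pooling_constant_offpath_response_fails
    (α β : ℝ) (L W : Bool → ℝ) (m a0 : Bool)
    (hα0 : 0 ≤ α) (hα1 : α < 1) (hβ0 : 0 < β) (hβ1 : β ≤ 1)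
    (hm : L m < W m) (hn : L (!m) < W (!m)) :
    payoff α β L W (!a0) (!m) (fun _ => a0) = W (!a0) ∧
    payoff α β L W (!a0) (!m) (fun _ => a0) >
      payoff α β L W (!a0) m (fun e => if e then !m else m) := by
  cases m <;> cases a0 <;>
    simp only [payoff, alarmProb, senderU, Bool.not_true, Bool.not_false] at * <;>
    norm_num at * <;> first | nlinarith | (constructor <;> nlinarith)
end

section
/- Let 0 ≤ α < β ≤ 1 with α + β < 2, let p ∈ (0,1), write ᾱ = 1−α, β̄ = 1−β, p̄ = 1−p, and define the conservative equilibrium sender strategies q = ᾱ(ᾱp̄ − β̄p)/((ᾱ² − β̄²)p̄) and r = β̄(ᾱp̄ − β̄p)/((ᾱ² − β̄²)p) (the case Δ0 = Δ1). Then the truth-induction rate τ = p̄(1−q) + p·r satisfies τ = (1−β)/(2−α−β) = (1/2)(1 − J/(1−G)), where J = β−α and G = β−(1−α); in particular τ < 1/2, i.e., a conservative detector induces a falsification convention in the Middle regime. -/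
/-- **Conservative detectors induce a falsification convention in the Middle regime.**
Let `0 ≤ α < β ≤ 1` with `α + β < 2`, `p ∈ (0,1)`, `ᾱ = 1−α`, `β̄ = 1−β`, `p̄ = 1−p`,
and let `q = ᾱ(ᾱp̄ − β̄p)/((ᾱ² − β̄²)p̄)` and `r = β̄(ᾱp̄ − β̄p)/((ᾱ² − β̄²)p)` be the
conservative equilibrium sender strategies (case `Δ0 = Δ1`). Then the truth-induction
rate `τ = p̄(1−q) + p·r` satisfies `τ = (1−β)/(2−α−β) = (1/2)(1 − J/(1−G))`, where
`J = β−α` and `G = β−(1−α)`; in particular `τ < 1/2`. -/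
theorem conservative_truth_induction
    (α β p q r : ℝ)
    (hα : 0 ≤ α) (hαβ : α < β) (hβ : β ≤ 1) (h2 : α + β < 2)
    (hp : 0 < p) (hp1 : p < 1)
    (hq : q = (1 - α) * ((1 - α) * (1 - p) - (1 - β) * p) /
      (((1 - α) ^ 2 - (1 - β) ^ 2) * (1 - p)))
    (hr : r = (1 - β) * ((1 - α) * (1 - p) - (1 - β) * p) /
      (((1 - α) ^ 2 - (1 - β) ^ 2) * p)) :
    (1 - p) * (1 - q) + p * r = (1 - β) / (2 - α - β) ∧
    (1 - β) / (2 - α - β) = (1 / 2) * (1 - (β - α) / (1 - (β - (1 - α)))) ∧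
    (1 - p) * (1 - q) + p * r < 1 / 2 := by
  have hJ : β - α ≠ 0 := sub_ne_zero.mpr hαβ.ne'
  have hs : 0 < 2 - α - β := by linarith
  have hs' : 2 - α - β ≠ 0 := hs.ne'
  have hp0 : p ≠ 0 := hp.ne'
  have hp1' : 1 - p ≠ 0 := sub_ne_zero.mpr hp1.ne'
  have hfac : (1 - α) ^ 2 - (1 - β) ^ 2 = (β - α) * (2 - α - β) := by ring
  have hG : 1 - (β - (1 - α)) = 2 - α - β := by ring
  have hτ : (1 - p) * (1 - q) + p * r = (1 - β) / (2 - α - β) := by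
    rw [hq, hr, hfac]
    field_simp
    ring
  refine ⟨hτ, ?_, ?_⟩
  · rw [hG]
    field_simp
    ring
  · rw [hτ, div_lt_iff₀ hs]
    linarith
end

section
/- Let 0 ≤ α < β ≤ 1, let p ∈ (0,1), write p̄ = 1−p, and define the aggressive equilibrium sender strategies q = α(βp − αp̄)/((β² − α²)p̄) and r = β(βp − αp̄)/((β² − α²)p) (the case Δ0 = Δ1). Then the truth-induction rate τ = p̄(1−q) + p·r satisfies τ = β/(α+β) = (1/2)(1 + J/(1+G)), where J = β−α and G = β−(1−α); in particular τ > 1/2, i.e., an aggressive detector induces a truth-telling convention in the Middle regime. -/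
/-- **Aggressive detectors induce a truth-telling convention in the Middle regime.**
Let `0 ≤ α < β ≤ 1`, `p ∈ (0,1)`, `p̄ = 1−p`, and let `q = α(βp − αp̄)/((β² − α²)p̄)`
and `r = β(βp − αp̄)/((β² − α²)p)` be the aggressive equilibrium sender strategies
(case `Δ0 = Δ1`). Then the truth-induction rate `τ = p̄(1−q) + p·r` satisfies
`τ = β/(α+β) = (1/2)(1 + J/(1+G))`, where `J = β−α` and `G = β−(1−α)`;
in particular `τ > 1/2`. -/
theorem aggressive_truth_induction
    (α β p q r : ℝ)
    (hα : 0 ≤ α) (hαβ : α < β) (hβ : β ≤ 1)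
    (hp : 0 < p) (hp1 : p < 1)
    (hq : q = α * (β * p - α * (1 - p)) / ((β ^ 2 - α ^ 2) * (1 - p)))
    (hr : r = β * (β * p - α * (1 - p)) / ((β ^ 2 - α ^ 2) * p)) :
    (1 - p) * (1 - q) + p * r = β / (α + β) ∧
    β / (α + β) = (1 / 2) * (1 + (β - α) / (1 + (β - (1 - α)))) ∧
    (1 - p) * (1 - q) + p * r > 1 / 2 := by
  have hsum : 0 < α + β := by linarith
  have hdiff : 0 < β - α := sub_pos.mpr hαβ
  have hp' : 0 < 1 - p := sub_pos.mpr hp1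
  have hτ : (1 - p) * (1 - q) + p * r = β / (α + β) := by
    have hsq : β ^ 2 - α ^ 2 = (β - α) * (α + β) := by ring
    rw [hq, hr, hsq]
    have h₁ := hsum.ne'
    have h₂ := hdiff.ne'
    have h₃ := hp'.ne'
    have h₄ := hp.ne'
    field_simp
    ring
  refine ⟨hτ, ?_, ?_⟩
  · have hG : 1 + (β - (1 - α)) = α + β := by ring
    rw [hG]
    field_simp
    ring
  · rw [hτ, gt_iff_lt, lt_div_iff₀ hsum]
    linarith
end

section
/- Let α, β ∈ [0,1] with α + β < 2, and set w = (1−α−β)/(2−α−β), x = 1, y = 1/(2−α−β), z = 0 (the receiver strategy of the conservative partially-separating equilibrium: σR(1|0,0) = w, σR(1|0,1) = x, σR(1|1,0) = y, σR(1|1,1) = z). Then for each sender type the induced probability of action a = 1 is the same for both messages: (1−α)w + αx = (1−β)y + βz = (1−β)/(2−α−β) for type θ = 0, and (1−β)w + βx = (1−α)y + αz = (1−α)/(2−α−β) for type θ = 1. Consequently, the receiver's a priori expected utility Σ_{θ,m,e,a} p(θ)σS(m|θ)λ(e|θ,m)σR(a|m,e)u^R(θ,a) is the same for every sender strategy σS.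 -/
/-- Detector evidence probability `λ(e|θ,m)`: alarm (`e = true`) with probability `α`
if the message is truthful (`m = θ`) and `β` if it is deceptive (`m ≠ θ`). -/
noncomputable def lam (α β : ℝ) (e θ m : Bool) : ℝ :=
  if e then (if m = θ then α else β) else (if m = θ then 1 - α else 1 - β)

/-- The receiver mixed strategy `σR(a=1|m,e)` given by the table
`σR(1|0,0) = w`, `σR(1|0,1) = x`, `σR(1|1,0) = y`, `σR(1|1,1) = z`. -/
noncomputable def sigR (w x y z : ℝ) (a m e : Bool) : ℝ :=
  (fun s => if a then s else 1 - s)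
    (if m then (if e then z else y) else (if e then x else w))

/-- The receiver's a priori expected utility
`Σ_{θ,m,e,a} p(θ) σS(m|θ) λ(e|θ,m) σR(a|m,e) u^R(θ,a)`. -/
noncomputable def aprioriEU (α β : ℝ) (p : Bool → ℝ) (σS : Bool → Bool → ℝ)
    (σR : Bool → Bool → Bool → ℝ) (uR : Bool → Bool → ℝ) : ℝ :=
  ∑ θ : Bool, ∑ m : Bool, ∑ e : Bool, ∑ a : Bool,
    p θ * σS m θ * lam α β e θ m * σR a m e * uR θ a

/-- If the two messages induce the same action probabilities for each type, the a priori
expected utility has a closed form not involving the sender strategy. -/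
theorem aprioriEU_sigR_eq_of_indifferent (α β w x y z : ℝ)
    (h0 : (1 - α) * w + α * x = (1 - β) * y + β * z)
    (h1 : (1 - β) * w + β * x = (1 - α) * y + α * z)
    (p : Bool → ℝ) (uR : Bool → Bool → ℝ) (σS : Bool → Bool → ℝ)
    (hσ : ∀ θ, σS false θ + σS true θ = 1) :
    aprioriEU α β p σS (sigR w x y z) uR =
      p false * (uR false false +
        ((1 - β) * y + β * z) * (uR false true - uR false false)) +
      p true * (uR true false +
        ((1 - α) * y + α * z) * (uR true true - uR true false)) := by
  simp only [aprioriEU, Fintype.sum_bool, lam, sigR, if_true, if_false, reduceCtorEq,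
    Bool.false_eq_true]
  linear_combination
    p false * σS false false * (uR false true - uR false false) * h0 +
    p true * σS false true * (uR true true - uR true false) * h1 +
    p false * (uR false false +
      ((1 - β) * y + β * z) * (uR false true - uR false false)) * hσ false +
    p true * (uR true false +
      ((1 - α) * y + α * z) * (uR true true - uR true false)) * hσ true

/-- **Robustness of the conservative equilibrium receiver strategy.** Let
`α, β ∈ [0,1]` with `α + β < 2`, and set `w = (1−α−β)/(2−α−β)`, `x = 1`,
`y = 1/(2−α−β)`, `z = 0`. Then for each sender type the induced probability of action
`a = 1` is the same for both messages: `(1−α)w + αx = (1−β)y + βz = (1−β)/(2−α−β)`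
for type `θ = 0` and `(1−β)w + βx = (1−α)y + αz = (1−α)/(2−α−β)` for type `θ = 1`;
consequently the receiver's a priori expected utility is the same for every sender
strategy. -/
theorem conservative_receiver_robust
    (α β : ℝ) (hα0 : 0 ≤ α) (hα1 : α ≤ 1) (hβ0 : 0 ≤ β) (hβ1 : β ≤ 1)
    (h2 : α + β < 2)
    (w x y z : ℝ)
    (hw : w = (1 - α - β) / (2 - α - β)) (hx : x = 1)
    (hy : y = 1 / (2 - α - β)) (hz : z = 0) :
    ((1 - α) * w + α * x = (1 - β) * y + β * z ∧
      (1 - β) * y + β * z = (1 - β) / (2 - α - β)) ∧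
    ((1 - β) * w + β * x = (1 - α) * y + α * z ∧
      (1 - α) * y + α * z = (1 - α) / (2 - α - β)) ∧
    (∀ (p : Bool → ℝ) (uR : Bool → Bool → ℝ) (σS σS' : Bool → Bool → ℝ),
      (∀ θ, σS false θ + σS true θ = 1) → (∀ θ, σS' false θ + σS' true θ = 1) →
      aprioriEU α β p σS (sigR w x y z) uR = aprioriEU α β p σS' (sigR w x y z) uR) := by
  have hd : 2 - α - β ≠ 0 := by linarith
  have h0 : (1 - α) * w + α * x = (1 - β) * y + β * z := by
    subst hw hx hy hz
    field_simp
    ring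
  have h1 : (1 - β) * w + β * x = (1 - α) * y + α * z := by
    subst hw hx hy hz
    field_simp
    ring
  refine ⟨⟨h0, ?_⟩, ⟨h1, ?_⟩, ?_⟩
  · rw [hy, hz]
    ring
  · rw [hy, hz]
    ring
  · intro p uR σS σS' hσ hσ'
    rw [aprioriEU_sigR_eq_of_indifferent α β w x y z h0 h1 p uR σS hσ,
      aprioriEU_sigR_eq_of_indifferent α β w x y z h0 h1 p uR σS' hσ']
end

section
/- Let α, β ∈ [0,1] with α + β > 0, and set w = 0, x = 1/(α+β), y = 1, z = (α+β−1)/(α+β) (the receiver strategy of the aggressive partially-separating equilibrium: σR(1|0,0) = w, σR(1|0,1) = x, σR(1|1,0) = y, σR(1|1,1) = z). Then for each sender type the induced probability of action a = 1 is the same for both messages: (1−α)w + αx = (1−β)y + βz = α/(α+β) for type θ = 0, and (1−β)w + βx = (1−α)y + αz = β/(α+β) for type θ = 1. Consequently, the receiver's a priori expected utility Σ_{θ,m,e,a} p(θ)σS(m|θ)λ(e|θ,m)σR(a|m,e)u^R(θ,a) is the same for every sender strategy σS. -/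
/-- If, for each sender type, both messages induce the same probability of the action `1`, then
the a priori expected utility does not depend on the sender strategy. -/
theorem aprioriEU_sigR_eq {α β w x y z q₀ q₁ : ℝ}
    (h₀w : (1 - α) * w + α * x = q₀) (h₀y : (1 - β) * y + β * z = q₀)
    (h₁w : (1 - β) * w + β * x = q₁) (h₁y : (1 - α) * y + α * z = q₁)
    (p : Bool → ℝ) (uR : Bool → Bool → ℝ) (σS : Bool → Bool → ℝ)
    (hσ : ∀ θ, σS false θ + σS true θ = 1) :
    aprioriEU α β p σS (sigR w x y z) uR =
      p false * (q₀ * uR false true + (1 - q₀) * uR false false) +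
        p true * (q₁ * uR true true + (1 - q₁) * uR true false) := by
  simp only [aprioriEU, sigR, lam, Fintype.sum_bool, if_true, if_false, Bool.false_eq_true,
    reduceCtorEq]
  linear_combination
    p false * (uR false true - uR false false) * (σS false false * h₀w + σS true false * h₀y) +
    p true * (uR true true - uR true false) * (σS false true * h₁w + σS true true * h₁y) +
    p false * (q₀ * uR false true + (1 - q₀) * uR false false) * hσ false +
    p true * (q₁ * uR true true + (1 - q₁) * uR true false) * hσ true

/-- **Robustness of the aggressive equilibrium receiver strategy.** Let
`α, β ∈ [0,1]` with `α + β > 0`, and set `w = 0`, `x = 1/(α+β)`, `y = 1`,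
`z = (α+β−1)/(α+β)`. Then for each sender type the induced probability of action
`a = 1` is the same for both messages: `(1−α)w + αx = (1−β)y + βz = α/(α+β)` for type
`θ = 0` and `(1−β)w + βx = (1−α)y + αz = β/(α+β)` for type `θ = 1`; consequently the
receiver's a priori expected utility is the same for every sender strategy. -/
theorem aggressive_receiver_robust
    (α β : ℝ) (hα0 : 0 ≤ α) (hα1 : α ≤ 1) (hβ0 : 0 ≤ β) (hβ1 : β ≤ 1)
    (h0 : 0 < α + β)
    (w x y z : ℝ)
    (hw : w = 0) (hx : x = 1 / (α + β))
    (hy : y = 1) (hz : z = (α + β - 1) / (α + β)) :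
    ((1 - α) * w + α * x = (1 - β) * y + β * z ∧
      (1 - β) * y + β * z = α / (α + β)) ∧
    ((1 - β) * w + β * x = (1 - α) * y + α * z ∧
      (1 - α) * y + α * z = β / (α + β)) ∧
    (∀ (p : Bool → ℝ) (uR : Bool → Bool → ℝ) (σS σS' : Bool → Bool → ℝ),
      (∀ θ, σS false θ + σS true θ = 1) → (∀ θ, σS' false θ + σS' true θ = 1) →
      aprioriEU α β p σS (sigR w x y z) uR = aprioriEU α β p σS' (sigR w x y z) uR) := by
  have hne : α + β ≠ 0 := h0.ne'
  have h₀w : (1 - α) * w + α * x = α / (α + β) := by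
    subst hw hx; field_simp; ring
  have h₀y : (1 - β) * y + β * z = α / (α + β) := by
    subst hy hz; field_simp; ring
  have h₁w : (1 - β) * w + β * x = β / (α + β) := by
    subst hw hx; field_simp; ring
  have h₁y : (1 - α) * y + α * z = β / (α + β) := by
    subst hy hz; field_simp; ring
  refine ⟨⟨h₀w.trans h₀y.symm, h₀y⟩, ⟨h₁w.trans h₁y.symm, h₁y⟩, ?_⟩
  intro p uR σS σS' hσ hσ'
  rw [aprioriEU_sigR_eq h₀w h₀y h₁w h₁y p uR σS hσ,
    aprioriEU_sigR_eq h₀w h₀y h₁w h₁y p uR σS' hσ']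
end

section
/- Let 0 < α < β ≤ 1, Δ0, Δ1 > 0, p ∈ (0,1), p̄ = 1−p, and let q = α(βpΔ1 − αp̄Δ0)/((β² − α²)p̄Δ0) and r = β(βpΔ1 − αp̄Δ0)/((β² − α²)pΔ1) (the aggressive equilibrium sender strategies). Assume βpΔ1 > αp̄Δ0 and αpΔ1 < βp̄Δ0 (equivalently, q, r ∈ (0,1)). Then the receiver's pure responses after no-alarm evidence are optimal: p̄(1−q)(1−α)Δ0 ≥ p(1−r)(1−β)Δ1 (so a = 0 maximizes posterior expected utility after (m,e) = (0,0)) and p̄·q·(1−β)Δ0 ≤ p·r·(1−α)Δ1 (so a = 1 maximizes posterior expected utility after (m,e) = (1,0)). -/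
/-- **Optimality of the receiver's pure no-alarm responses in the aggressive
partially-separating equilibrium.** Let `0 < α < β ≤ 1`, `Δ0, Δ1 > 0`, `p ∈ (0,1)`,
`p̄ = 1−p`, and let `q = α(βpΔ1 − αp̄Δ0)/((β² − α²)p̄Δ0)` and
`r = β(βpΔ1 − αp̄Δ0)/((β² − α²)pΔ1)`. Assume `βpΔ1 > αp̄Δ0` and `αpΔ1 < βp̄Δ0`
(equivalently, `q, r ∈ (0,1)`). Then `p̄(1−q)(1−α)Δ0 ≥ p(1−r)(1−β)Δ1` (so `a = 0`
maximizes posterior expected utility after `(m,e) = (0,0)`) and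
`p̄·q·(1−β)Δ0 ≤ p·r·(1−α)Δ1` (so `a = 1` maximizes posterior expected utility after
`(m,e) = (1,0)`). -/
theorem aggressive_pure_responses_optimal
    (α β Δ0 Δ1 p q r : ℝ)
    (hα : 0 < α) (hαβ : α < β) (hβ : β ≤ 1)
    (hΔ0 : 0 < Δ0) (hΔ1 : 0 < Δ1) (hp : 0 < p) (hp1 : p < 1)
    (hq : q = α * (β * p * Δ1 - α * (1 - p) * Δ0) / ((β ^ 2 - α ^ 2) * (1 - p) * Δ0))
    (hr : r = β * (β * p * Δ1 - α * (1 - p) * Δ0) / ((β ^ 2 - α ^ 2) * p * Δ1))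
    (h1 : β * p * Δ1 > α * (1 - p) * Δ0)
    (h2 : α * p * Δ1 < β * (1 - p) * Δ0) :
    (1 - p) * (1 - q) * (1 - α) * Δ0 ≥ p * (1 - r) * (1 - β) * Δ1 ∧
    (1 - p) * q * (1 - β) * Δ0 ≤ p * r * (1 - α) * Δ1 := by
  have hp' : 0 < 1 - p := sub_pos.mpr hp1
  have hD : 0 < β ^ 2 - α ^ 2 := by nlinarith
  have hDne := hD.ne'
  set D := β ^ 2 - α ^ 2 with hD_def
  set s := (β * p * Δ1 - α * (1 - p) * Δ0) / D with hs
  set t := (β * (1 - p) * Δ0 - α * p * Δ1) / D with ht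
  have hs0 : 0 ≤ s := div_nonneg (by linarith) hD.le
  have ht0 : 0 ≤ t := div_nonneg (by linarith) hD.le
  have hq0 : (1 - p) * Δ0 * q = α * s := by
    rw [hq, hs]; field_simp
  have hr1 : p * Δ1 * r = β * s := by
    rw [hr, hs]; field_simp
  have hq1 : (1 - p) * Δ0 * (1 - q) = β * t := by
    rw [mul_sub, hq0, hs, ht]; field_simp; rw [hD_def]; ring
  have hr0 : p * Δ1 * (1 - r) = α * t := by
    rw [mul_sub, hr1, hs, ht]; field_simp; rw [hD_def]; ring
  have hle : α * (1 - β) ≤ β * (1 - α) := by linarith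
  constructor
  · calc p * (1 - r) * (1 - β) * Δ1 = p * Δ1 * (1 - r) * (1 - β) := by ring
      _ = α * (1 - β) * t := by rw [hr0]; ring
      _ ≤ β * (1 - α) * t := by gcongr
      _ = (1 - p) * Δ0 * (1 - q) * (1 - α) := by rw [hq1]; ring
      _ = (1 - p) * (1 - q) * (1 - α) * Δ0 := by ring
  · calc (1 - p) * q * (1 - β) * Δ0 = (1 - p) * Δ0 * q * (1 - β) := by ring
      _ = α * (1 - β) * s := by rw [hq0]; ring
      _ ≤ β * (1 - α) * s := by gcongr
      _ = p * Δ1 * r * (1 - α) := by rw [hr1]; ring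
      _ = p * r * (1 - α) * Δ1 := by ring
end

section
/- Let 0 ≤ α < β < 1, Δ0, Δ1 > 0, p ∈ (0,1), ᾱ = 1−α, β̄ = 1−β, p̄ = 1−p, and let q = ᾱ(ᾱp̄Δ0 − β̄pΔ1)/((ᾱ² − β̄²)p̄Δ0) and r = β̄(ᾱp̄Δ0 − β̄pΔ1)/((ᾱ² − β̄²)pΔ1) (the conservative equilibrium sender strategies). Assume ᾱp̄Δ0 > β̄pΔ1 and β̄p̄Δ0 < ᾱpΔ1 (equivalently, q, r ∈ (0,1)). Then the receiver's pure responses after alarm evidence are optimal: p̄(1−q)·α·Δ0 ≤ p(1−r)·β·Δ1 (so a = 1 maximizes posterior expected utility after (m,e) = (0,1)) and p̄·q·β·Δ0 ≥ p·r·α·Δ1 (so a = 0 maximizes posterior expected utility after (m,e) = (1,1)). -/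
/-- **Optimality of the receiver's pure alarm responses in the conservative
partially-separating equilibrium.** Let `0 ≤ α < β < 1`, `Δ0, Δ1 > 0`, `p ∈ (0,1)`,
`ᾱ = 1−α`, `β̄ = 1−β`, `p̄ = 1−p`, and let
`q = ᾱ(ᾱp̄Δ0 − β̄pΔ1)/((ᾱ² − β̄²)p̄Δ0)` and `r = β̄(ᾱp̄Δ0 − β̄pΔ1)/((ᾱ² − β̄²)pΔ1)`.
Assume `ᾱp̄Δ0 > β̄pΔ1` and `β̄p̄Δ0 < ᾱpΔ1` (equivalently, `q, r ∈ (0,1)`). Then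
`p̄(1−q)·α·Δ0 ≤ p(1−r)·β·Δ1` (so `a = 1` maximizes posterior expected utility after
`(m,e) = (0,1)`) and `p̄·q·β·Δ0 ≥ p·r·α·Δ1` (so `a = 0` maximizes posterior expected
utility after `(m,e) = (1,1)`). -/
theorem conservative_pure_responses_optimal
    (α β Δ0 Δ1 p q r : ℝ)
    (hα : 0 ≤ α) (hαβ : α < β) (hβ : β < 1)
    (hΔ0 : 0 < Δ0) (hΔ1 : 0 < Δ1) (hp : 0 < p) (hp1 : p < 1)
    (hq : q = (1 - α) * ((1 - α) * (1 - p) * Δ0 - (1 - β) * p * Δ1) /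
      (((1 - α) ^ 2 - (1 - β) ^ 2) * (1 - p) * Δ0))
    (hr : r = (1 - β) * ((1 - α) * (1 - p) * Δ0 - (1 - β) * p * Δ1) /
      (((1 - α) ^ 2 - (1 - β) ^ 2) * p * Δ1))
    (h1 : (1 - α) * (1 - p) * Δ0 > (1 - β) * p * Δ1)
    (h2 : (1 - β) * (1 - p) * Δ0 < (1 - α) * p * Δ1) :
    (1 - p) * (1 - q) * α * Δ0 ≤ p * (1 - r) * β * Δ1 ∧
    (1 - p) * q * β * Δ0 ≥ p * r * α * Δ1 := by
  have hp' : 0 < 1 - p := by linarith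
  have hD : 0 < (1 - α) ^ 2 - (1 - β) ^ 2 := by nlinarith
  have hslope : (1 - β) * α ≤ (1 - α) * β := by linarith
  have hD0 := hD.ne'
  have hp0 := hp'.ne'
  constructor
  · have hl : 0 ≤ ((1 - α) * p * Δ1 - (1 - β) * (1 - p) * Δ0) /
        ((1 - α) ^ 2 - (1 - β) ^ 2) := div_nonneg (by linarith) hD.le
    have e0 : (1 - p) * (1 - q) * α * Δ0 = (1 - β) * α *
        (((1 - α) * p * Δ1 - (1 - β) * (1 - p) * Δ0) / ((1 - α) ^ 2 - (1 - β) ^ 2)) := by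
      rw [hq]
      field_simp
      ring
    have e1 : p * (1 - r) * β * Δ1 = (1 - α) * β *
        (((1 - α) * p * Δ1 - (1 - β) * (1 - p) * Δ0) / ((1 - α) ^ 2 - (1 - β) ^ 2)) := by
      rw [hr]
      field_simp
      ring
    rw [e0, e1]
    exact mul_le_mul_of_nonneg_right hslope hl
  · have hk : 0 ≤ ((1 - α) * (1 - p) * Δ0 - (1 - β) * p * Δ1) /
        ((1 - α) ^ 2 - (1 - β) ^ 2) := div_nonneg (by linarith) hD.le
    have e0 : (1 - p) * q * β * Δ0 = (1 - α) * β *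
        (((1 - α) * (1 - p) * Δ0 - (1 - β) * p * Δ1) / ((1 - α) ^ 2 - (1 - β) ^ 2)) := by
      rw [hq]
      field_simp
    have e1 : p * r * α * Δ1 = (1 - β) * α *
        (((1 - α) * (1 - p) * Δ0 - (1 - β) * p * Δ1) / ((1 - α) ^ 2 - (1 - β) ^ 2)) := by
      rw [hr]
      field_simp
    rw [e0, e1]
    exact mul_le_mul_of_nonneg_right hslope hk
end

section
/- Let 0 ≤ α < β ≤ 1 with α + β ≠ 1. Then there is no pair (y, z) ∈ [0,1]² satisfying both (1−β)y + βz ≤ α and (1−α)y + αz ≥ β. Consequently, if both sender types pool on m = 0 and the receiver's on-path responses are a = 0 when e = 0 and a = 1 when e = 1, then for every off-path response rule (y = σR(a=1|m=1,e=0), z = σR(a=1|m=1,e=1)) at least one sender type strictly increases her probability of successful deception (action a ≠ θ) by deviating to message m = 1; hence no off-path belief and response can sustain such a pooling equilibrium when β ≠ 1−α. -/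
/-- The two no-deviation constraints force the off-path responses to be `y = 1`, `z = 0`,
and hence `α + β = 1`. -/
theorem add_eq_one_of_no_deviation {α β y z : ℝ} (hαβ : α < β) (hy : y ≤ 1) (hz : 0 ≤ z)
    (h₀ : (1 - β) * y + β * z ≤ α) (h₁ : β ≤ (1 - α) * y + α * z) : α + β = 1 := by
  have hd : 1 ≤ y - z := by
    refine le_of_mul_le_mul_left ?_ (sub_pos.mpr hαβ)
    linarith
  obtain rfl : y = 1 := by linarith
  obtain rfl : z = 0 := by linarith
  linarith

/-- **No off-path response sustains pooling on `m = 0` with evidence-dependent on-path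
play when `β ≠ 1−α`.** Let `0 ≤ α < β ≤ 1` with `α + β ≠ 1`. Then there is no pair
`(y, z) ∈ [0,1]²` with `(1−β)y + βz ≤ α` and `(1−α)y + αz ≥ β`. Consequently, under
pooling on `m = 0` with on-path responses `a = 0` when `e = 0` and `a = 1` when
`e = 1`, for every off-path response rule `(y, z)` at least one sender type strictly
increases her probability of successful deception by deviating to `m = 1`: either the
type-0 sender's deviation probability of `a = 1` exceeds her on-path probability `α`,
or the type-1 sender's deviation probability of `a = 1` falls below her on-path
probability `β`. -/
theorem no_offpath_response_sustains_pooling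
    (α β : ℝ) (hα : 0 ≤ α) (hαβ : α < β) (hβ : β ≤ 1) (hne : α + β ≠ 1) :
    (¬ ∃ y z : ℝ, (0 ≤ y ∧ y ≤ 1) ∧ (0 ≤ z ∧ z ≤ 1) ∧
      (1 - β) * y + β * z ≤ α ∧ (1 - α) * y + α * z ≥ β) ∧
    (∀ y z : ℝ, 0 ≤ y → y ≤ 1 → 0 ≤ z → z ≤ 1 →
      (1 - β) * y + β * z > α ∨ (1 - α) * y + α * z < β) := by
  have key : ∀ y z : ℝ, 0 ≤ y → y ≤ 1 → 0 ≤ z → z ≤ 1 →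
      (1 - β) * y + β * z > α ∨ (1 - α) * y + α * z < β := by
    intro y z _ hy hz _
    by_contra! h
    exact hne (add_eq_one_of_no_deviation hαβ hy hz h.1 h.2)
  refine ⟨?_, key⟩
  rintro ⟨y, z, ⟨hy₀, hy₁⟩, ⟨hz₀, hz₁⟩, h₀, h₁⟩
  exact (key y z hy₀ hy₁ hz₀ hz₁).elim h₀.not_gt h₁.not_gt
end
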